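/- arXiv:2110.13532 — 4 statements merged into one kernel-verified Lean document; each statement's English description precedes it below -/
import Mathlib

section
/- Fix positive integers n, m, l, matrices A12 ∈ ℝ^{n×m}, A13 ∈ ℝ^{n×l}, A21, A21₀ ∈ ℝ^{n×m}, A31, A31₀ ∈ ℝ^{n×l}, A23, A32 ∈ ℝ^{m×l}, and indices i* ∈ [n], j* ∈ [m], k* ∈ [l]. Assume: (i) for all k and all j ≠ j*, A21(i*, j*) + A23(j*, k) > A21(i*, j) + A23(j, k); (ii) for all j and all k ≠ k*, A31(i*, k*) + A32(j, k*) > A31(i*, k) + A32(j, k); (iii) with c1 := A12(i*, j*) + A13(i*, k*) − ‖A21 − A21₀‖∞ − ‖A31 − A31₀‖∞, c2 := A21(i*, j*) + A23(j*, k*), c3 := A31(i*, k*) + A32(j*, k*), we have c1 ≥ c2 and c1 ≥ c3. Let (Ω, ℱ, μ) be a probability space and Y : Ω → ℕ → [m], Z : Ω → ℕ → [l] be the opponents' action sequences, and suppose that for μ-almost every ω, #{t ≤ T : Y(ω)(t) = j*}/T → 1 and #{t ≤ T : Z(ω)(t) = k*}/T → 1 as T → ∞. Define the realized round-t utilities u1(ω)(t)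 = A12(i*, Y(ω)(t)) + A13(i*, Z(ω)(t)) − ‖A21 − A21₀‖∞ − ‖A31 − A31₀‖∞, u2(ω)(t) = A21(i*, Y(ω)(t)) + A23(Y(ω)(t), Z(ω)(t)), u3(ω)(t) = A31(i*, Z(ω)(t)) + A32(Y(ω)(t), Z(ω)(t)). Then for μ-almost every ω, each average (1/T) ∑_{t≤T} u_i(ω)(t) converges to c_i, and lim_T (1/T) ∑_{t≤T} u_1 ≥ lim_T (1/T) ∑_{t≤T} u_2 and lim_T (1/T) ∑_{t≤T} u_1 ≥ lim_T (1/T) ∑_{t≤T} u_3. (Theorem 1: a winning dominance solvable type-I policy wins almost surely against consistent agents.) -/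
open Filter Finset MeasureTheory
open scoped Classical Topology

/-- The infinity norm of a payoff matrix: the maximum absolute value of an entry. -/
noncomputable def infNorm {n m : ℕ} (A : Matrix (Fin n) (Fin m) ℝ) : ℝ :=
  ⨆ i, ⨆ j, |A i j|

/-- If two sequences equal `a` and `b` respectively a fraction of time converging to one, then the
time averages of any payoff depending on both converge to the payoff at `(a, b)`. -/
theorem tendsto_average_of_frequency_tendsto_one {α β : Type*} [Finite α] [Finite β]
    [DecidableEq α] [DecidableEq β] (y : ℕ → α) (z : ℕ → β) (a : α) (b : β) (g : α → β → ℝ)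
    (hy : Tendsto (fun T : ℕ => (((Finset.Icc 1 T).filter (fun t => y t = a)).card : ℝ) / (T : ℝ))
      atTop (nhds 1))
    (hz : Tendsto (fun T : ℕ => (((Finset.Icc 1 T).filter (fun t => z t = b)).card : ℝ) / (T : ℝ))
      atTop (nhds 1)) :
    Tendsto (fun T : ℕ => (1 / (T : ℝ)) * ∑ t ∈ Finset.Icc 1 T, g (y t) (z t))
      atTop (nhds (g a b)) := by
  obtain ⟨C, hC⟩ : ∃ C, ∀ p : α × β, |g p.1 p.2 - g a b| ≤ C := by
    obtain ⟨C, hC⟩ := (Set.finite_range fun p : α × β => |g p.1 p.2 - g a b|).bddAbove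
    exact ⟨C, fun p => hC ⟨p, rfl⟩⟩
  have hC0 : 0 ≤ C := (abs_nonneg _).trans (hC (a, b))
  have hbound (t : ℕ) : |g (y t) (z t) - g a b| ≤
      C * ((1 - if y t = a then 1 else 0) + (1 - if z t = b then 1 else 0)) := by
    have h := hC (y t, z t)
    by_cases h1 : y t = a <;> by_cases h2 : z t = b
    · simp [h1, h2]
    all_goals
      simp only [h1, h2, if_true, if_false] at h ⊢
      linarith
  rw [tendsto_iff_norm_sub_tendsto_zero]
  have hlim := ((hy.const_sub 1).add (hz.const_sub 1)).const_mul C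
  simp only [sub_self, add_zero, mul_zero] at hlim
  refine squeeze_zero' (Eventually.of_forall fun _ => norm_nonneg _) ?_ hlim
  filter_upwards [eventually_gt_atTop 0] with T hT
  have hT' : (0 : ℝ) < T := by exact_mod_cast hT
  have hdiff : (1 / (T : ℝ)) * ∑ t ∈ Finset.Icc 1 T, g (y t) (z t) - g a b
      = (∑ t ∈ Finset.Icc 1 T, (g (y t) (z t) - g a b)) / T := by
    rw [Finset.sum_sub_distrib]
    simp only [sum_const, Nat.card_Icc, add_tsub_cancel_right, nsmul_eq_mul]
    field_simp
  rw [hdiff, Real.norm_eq_abs, abs_div, abs_of_pos hT', div_le_iff₀ hT']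
  calc |∑ t ∈ Finset.Icc 1 T, (g (y t) (z t) - g a b)|
      ≤ ∑ t ∈ Finset.Icc 1 T, |g (y t) (z t) - g a b| := abs_sum_le_sum_abs _ _
    _ ≤ ∑ t ∈ Finset.Icc 1 T,
        C * ((1 - if y t = a then 1 else 0) + (1 - if z t = b then 1 else 0)) :=
      Finset.sum_le_sum fun t _ => hbound t
    _ = _ := by
      rw [← Finset.mul_sum, Finset.sum_add_distrib, Finset.sum_sub_distrib,
        Finset.sum_sub_distrib, Finset.sum_boole, Finset.sum_boole]
      simp only [sum_const, Nat.card_Icc, add_tsub_cancel_right, nsmul_eq_mul]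
      field_simp

/-- Theorem 1: a winning dominance solvable type-I policy wins almost surely
against consistent agents. -/
theorem stmt_4 (n m l : ℕ)
    (A12 : Matrix (Fin n) (Fin m) ℝ) (A13 : Matrix (Fin n) (Fin l) ℝ)
    (A21 A21o : Matrix (Fin n) (Fin m) ℝ) (A31 A31o : Matrix (Fin n) (Fin l) ℝ)
    (A23 A32 : Matrix (Fin m) (Fin l) ℝ)
    (istar : Fin n) (jstar : Fin m) (kstar : Fin l)
    -- (i): system (1), `jstar` strictly dominant for player 2 against `istar`
    (hdom2 : ∀ k : Fin l, ∀ j : Fin m, j ≠ jstar →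
      A21 istar jstar + A23 jstar k > A21 istar j + A23 j k)
    -- (ii): system (2), `kstar` strictly dominant for player 3 against `istar`
    (hdom3 : ∀ j : Fin m, ∀ k : Fin l, k ≠ kstar →
      A31 istar kstar + A32 j kstar > A31 istar k + A32 j k)
    -- (iii): the winning condition (4)
    (c1 c2 c3 : ℝ)
    (hc1 : c1 = A12 istar jstar + A13 istar kstar
      - infNorm (A21 - A21o) - infNorm (A31 - A31o))
    (hc2 : c2 = A21 istar jstar + A23 jstar kstar)
    (hc3 : c3 = A31 istar kstar + A32 jstar kstar)
    (hw2 : c1 ≥ c2) (hw3 : c1 ≥ c3)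
    {Ω : Type*} [MeasurableSpace Ω] (μ : Measure Ω) [IsProbabilityMeasure μ]
    (Y : Ω → ℕ → Fin m) (Z : Ω → ℕ → Fin l)
    -- consistency of players 2 and 3
    (hY : ∀ᵐ ω ∂μ, Tendsto
      (fun T : ℕ => (((Finset.Icc 1 T).filter (fun t => Y ω t = jstar)).card : ℝ) / (T : ℝ))
      atTop (nhds 1))
    (hZ : ∀ᵐ ω ∂μ, Tendsto
      (fun T : ℕ => (((Finset.Icc 1 T).filter (fun t => Z ω t = kstar)).card : ℝ) / (T : ℝ))
      atTop (nhds 1)) :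
    ∀ᵐ ω ∂μ,
      Tendsto (fun T : ℕ => (1 / (T : ℝ)) * ∑ t ∈ Finset.Icc 1 T,
        (A12 istar (Y ω t) + A13 istar (Z ω t)
          - infNorm (A21 - A21o) - infNorm (A31 - A31o))) atTop (nhds c1) ∧
      Tendsto (fun T : ℕ => (1 / (T : ℝ)) * ∑ t ∈ Finset.Icc 1 T,
        (A21 istar (Y ω t) + A23 (Y ω t) (Z ω t))) atTop (nhds c2) ∧
      Tendsto (fun T : ℕ => (1 / (T : ℝ)) * ∑ t ∈ Finset.Icc 1 T,
        (A31 istar (Z ω t) + A32 (Y ω t) (Z ω t))) atTop (nhds c3) := by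
  subst hc1 hc2 hc3
  filter_upwards [hY, hZ] with ω hy hz
  have key := fun g => tendsto_average_of_frequency_tendsto_one (Y ω) (Z ω) jstar kstar g
    (by convert hy) (by convert hz)
  exact ⟨key fun j k => A12 istar j + A13 istar k
      - infNorm (A21 - A21o) - infNorm (A31 - A31o),
    key fun j k => A21 istar j + A23 j k, key fun j k => A31 istar k + A32 j k⟩
end

section
/- Fix positive integers n, m, l, matrices A12 ∈ ℝ^{n×m}, A13 ∈ ℝ^{n×l}, A21, A21₀ ∈ ℝ^{n×m}, A31, A31₀ ∈ ℝ^{n×l}, A23, A32 ∈ ℝ^{m×l}, and indices i*, j*, k*. Assume all the quantities A21(i*, j) + A23(j, k) and A31(i*, k) + A32(j, k) lie in [−1, 1]. Assume: (i) for all k and all j ≠ j*, A21(i*, j*) + A23(j*, k) > A21(i*, j) + A23(j, k); (ii) for all k ≠ k*, A31(i*, k*) + A32(j*, k*) > A31(i*, k) + A32(j*, k); (iii) c1 := A12(i*, j*) + A13(i*, k*) − ‖A21 − A21₀‖∞ − ‖A31 − A31₀‖∞ satisfies c1 ≥ c2 := A21(i*, j*) + A23(j*, k*) and c1 ≥ c3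 := A31(i*, k*) + A32(j*, k*). Let (Ω, ℱ, μ) be a probability space and Y : Ω → ℕ → [m], Z : Ω → ℕ → [l] action sequences such that for μ-almost every ω: (a) #{t ≤ T : Y(ω)(t) = j*}/T → 1, and (b) if there exists T_h such that for all T ≥ T_h the action k* is the unique maximizer over k ∈ [l] of ∑_{t=1}^{T} (A31(i*, k) + A32(Y(ω)(t), k)), then #{t ≤ T : Z(ω)(t) = k*}/T → 1. Define u1, u2, u3 as the realized round utilities u1(ω)(t) = A12(i*, Y(ω)(t)) + A13(i*, Z(ω)(t)) − ‖A21 − A21₀‖∞ − ‖A31 − A31₀‖∞, u2(ω)(t) = A21(i*, Y(ω)(t)) + A23(Y(ω)(t), Z(ω)(t)), u3(ω)(t) = A31(i*, Z(ω)(t)) + A32(Y(ω)(t), Z(ω)(t)). Then for μ-almost every ω, lim_T (1/T) ∑_{t≤T} u_1 ≥ lim_T (1/T) ∑_{t≤T} u_2 and lim_T (1/T) ∑_{t≤T} u_1 ≥ lim_T (1/T) ∑_{t≤T} u_3, all limits existing. (Theorem 2: a winning dominance solvable type-II policy wins almost surely against a consistent player 2 and a persistent player 3.) -/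
open Filter Finset MeasureTheory
open scoped Classical Topology

/-- If two events occur with asymptotic frequency one, then the averages of a bounded sequence
that equals `c` whenever both of them occur converge to `c`. -/
lemma tendsto_average_of_frequency_one {P Q : ℕ → Prop} [DecidablePred P] [DecidablePred Q]
    (hP : Tendsto (fun T : ℕ => (((Finset.Icc 1 T).filter P).card : ℝ) / (T : ℝ)) atTop (𝓝 1))
    (hQ : Tendsto (fun T : ℕ => (((Finset.Icc 1 T).filter Q).card : ℝ) / (T : ℝ)) atTop (𝓝 1))
    {f : ℕ → ℝ} {c B : ℝ} (hB : ∀ t, |f t - c| ≤ B) (hf : ∀ t, P t → Q t → f t = c) :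
    Tendsto (fun T : ℕ => (1 / (T : ℝ)) * ∑ t ∈ Finset.Icc 1 T, f t) atTop (𝓝 c) := by
  have hB0 : 0 ≤ B := (abs_nonneg _).trans (hB 0)
  have hlim := ((hP.const_sub 1).add (hQ.const_sub 1)).const_mul B
  rw [sub_self, add_zero, mul_zero] at hlim
  rw [tendsto_iff_norm_sub_tendsto_zero]
  refine squeeze_zero' (Eventually.of_forall fun _ => norm_nonneg _) ?_ hlim
  filter_upwards [eventually_ge_atTop 1] with T hT
  have hT0 : (0 : ℝ) < T := by exact_mod_cast hT
  have hpt : ∀ t, |f t - c| ≤ B * ((1 - if P t then 1 else 0) + (1 - if Q t then 1 else 0)) := by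
    intro t
    have := hB t
    by_cases hp : P t <;> by_cases hq : Q t
    · simp [hp, hq, hf t hp hq]
    · simpa [hp, hq] using this
    · simpa [hp, hq] using this
    · simp only [hp, hq, if_false]
      linarith
  have hsum : |∑ t ∈ Finset.Icc 1 T, (f t - c)| ≤ B * ((T - ((Finset.Icc 1 T).filter P).card) +
      (T - ((Finset.Icc 1 T).filter Q).card)) := by
    refine (Finset.abs_sum_le_sum_abs _ _).trans ((Finset.sum_le_sum fun t _ => hpt t).trans ?_)
    rw [← Finset.mul_sum, Finset.sum_add_distrib, Finset.sum_sub_distrib, Finset.sum_sub_distrib,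
      Finset.sum_boole, Finset.sum_boole]
    simp
  have heq : (1 / (T : ℝ)) * ∑ t ∈ Finset.Icc 1 T, f t - c =
      (∑ t ∈ Finset.Icc 1 T, (f t - c)) / T := by
    rw [Finset.sum_sub_distrib]
    simp
    field_simp
  rw [heq, Real.norm_eq_abs, abs_div, abs_of_pos hT0, div_le_iff₀ hT0]
  refine hsum.trans (le_of_eq ?_)
  field_simp

/-- If two sequences in finite types take the values `a` and `b` with asymptotic frequency one,
then the averages of any function `g` along them converge to `g a b`. -/
lemma tendsto_average_of_eq_frequency_one {α β : Type*} [Finite α] [Finite β] [DecidableEq α]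
    [DecidableEq β] {y : ℕ → α} {z : ℕ → β} {a : α} {b : β}
    (hy : Tendsto (fun T : ℕ => (((Finset.Icc 1 T).filter (fun t => y t = a)).card : ℝ) / (T : ℝ))
      atTop (𝓝 1))
    (hz : Tendsto (fun T : ℕ => (((Finset.Icc 1 T).filter (fun t => z t = b)).card : ℝ) / (T : ℝ))
      atTop (𝓝 1))
    (g : α → β → ℝ) :
    Tendsto (fun T : ℕ => (1 / (T : ℝ)) * ∑ t ∈ Finset.Icc 1 T, g (y t) (z t)) atTop
      (𝓝 (g a b)) := by
  obtain ⟨B, hB⟩ := (Set.finite_range fun p : α × β => |g p.1 p.2 - g a b|).bddAbove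
  refine tendsto_average_of_frequency_one hy hz (B := B)
    (fun t => hB ⟨(y t, z t), rfl⟩) fun t h1 h2 => ?_
  rw [h1, h2]

/-- If `y` takes the value `a` with asymptotic frequency one and `b` is the unique maximizer of
`g a`, then `b` is eventually the unique maximizer of the sums of `g` along `y`. -/
lemma exists_forall_sum_lt_of_eq_frequency_one {α β : Type*} [Finite α] [Finite β] [DecidableEq α]
    {y : ℕ → α} {a : α} {b : β}
    (hy : Tendsto (fun T : ℕ => (((Finset.Icc 1 T).filter (fun t => y t = a)).card : ℝ) / (T : ℝ))
      atTop (𝓝 1))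
    {g : α → β → ℝ} (hg : ∀ k, k ≠ b → g a k < g a b) :
    ∃ N : ℕ, ∀ T : ℕ, T ≥ N → ∀ k, k ≠ b →
      ∑ t ∈ Finset.Icc 1 T, g (y t) k < ∑ t ∈ Finset.Icc 1 T, g (y t) b := by
  refine eventually_atTop.1 (eventually_all.2 fun k => ?_)
  by_cases hk : k = b
  · exact Eventually.of_forall fun _ h => absurd hk h
  have hlim := tendsto_average_of_eq_frequency_one hy hy fun j _ => g j b - g j k
  filter_upwards [hlim.eventually (lt_mem_nhds (sub_pos.2 (hg k hk)))] with T hT _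
  rw [Finset.sum_sub_distrib] at hT
  exact sub_pos.1 (pos_of_mul_pos_right hT (by positivity))

/-- Theorem 2: a winning dominance solvable type-II policy wins almost surely against
a consistent player 2 and a persistent player 3. -/
theorem stmt_6 (n m l : ℕ)
    (A12 : Matrix (Fin n) (Fin m) ℝ) (A13 : Matrix (Fin n) (Fin l) ℝ)
    (A21 A21o : Matrix (Fin n) (Fin m) ℝ) (A31 A31o : Matrix (Fin n) (Fin l) ℝ)
    (A23 A32 : Matrix (Fin m) (Fin l) ℝ)
    (istar : Fin n) (jstar : Fin m) (kstar : Fin l)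
    -- single-shot opponent utilities are bounded in [-1, 1]
    (hbdd : ∀ (j : Fin m) (k : Fin l),
      |A21 istar j + A23 j k| ≤ 1 ∧ |A31 istar k + A32 j k| ≤ 1)
    -- (i): system (1), `jstar` strictly dominant for player 2 against `istar`
    (hdom2 : ∀ k : Fin l, ∀ j : Fin m, j ≠ jstar →
      A21 istar jstar + A23 jstar k > A21 istar j + A23 j k)
    -- (ii): system (3), `kstar` the unique best response for player 3 against `(istar, jstar)`
    (hdom3 : ∀ k : Fin l, k ≠ kstar →
      A31 istar kstar + A32 jstar kstar > A31 istar k + A32 jstar k)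
    -- (iii): the winning condition
    (c1 c2 c3 : ℝ)
    (hc1 : c1 = A12 istar jstar + A13 istar kstar
      - infNorm (A21 - A21o) - infNorm (A31 - A31o))
    (hc2 : c2 = A21 istar jstar + A23 jstar kstar)
    (hc3 : c3 = A31 istar kstar + A32 jstar kstar)
    (hw2 : c1 ≥ c2) (hw3 : c1 ≥ c3)
    {Ω : Type*} [MeasurableSpace Ω] (μ : Measure Ω) [IsProbabilityMeasure μ]
    (Y : Ω → ℕ → Fin m) (Z : Ω → ℕ → Fin l)
    -- (a): consistency of player 2
    (hY : ∀ᵐ ω ∂μ, Tendsto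
      (fun T : ℕ => (((Finset.Icc 1 T).filter (fun t => Y ω t = jstar)).card : ℝ) / (T : ℝ))
      atTop (nhds 1))
    -- (b): persistence of player 3
    (hZ : ∀ᵐ ω ∂μ,
      (∃ Th : ℕ, ∀ T : ℕ, T ≥ Th → ∀ k : Fin l, k ≠ kstar →
        ∑ t ∈ Finset.Icc 1 T, (A31 istar kstar + A32 (Y ω t) kstar) >
          ∑ t ∈ Finset.Icc 1 T, (A31 istar k + A32 (Y ω t) k)) →
      Tendsto
        (fun T : ℕ => (((Finset.Icc 1 T).filter (fun t => Z ω t = kstar)).card : ℝ) / (T : ℝ))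
        atTop (nhds 1)) :
    ∀ᵐ ω ∂μ,
      Tendsto (fun T : ℕ => (1 / (T : ℝ)) * ∑ t ∈ Finset.Icc 1 T,
        (A12 istar (Y ω t) + A13 istar (Z ω t)
          - infNorm (A21 - A21o) - infNorm (A31 - A31o))) atTop (nhds c1) ∧
      Tendsto (fun T : ℕ => (1 / (T : ℝ)) * ∑ t ∈ Finset.Icc 1 T,
        (A21 istar (Y ω t) + A23 (Y ω t) (Z ω t))) atTop (nhds c2) ∧
      Tendsto (fun T : ℕ => (1 / (T : ℝ)) * ∑ t ∈ Finset.Icc 1 T,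
        (A31 istar (Z ω t) + A32 (Y ω t) (Z ω t))) atTop (nhds c3) := by
  filter_upwards [hY, hZ] with ω hy hz
  have hz := hz (exists_forall_sum_lt_of_eq_frequency_one hy
    (g := fun j k => A31 istar k + A32 j k) hdom3)
  subst hc1 hc2 hc3
  exact ⟨tendsto_average_of_eq_frequency_one hy hz fun j k => A12 istar j + A13 istar k
      - infNorm (A21 - A21o) - infNorm (A31 - A31o),
    tendsto_average_of_eq_frequency_one hy hz fun j k => A21 istar j + A23 j k,
    tendsto_average_of_eq_frequency_one hy hz fun j k => A31 istar k + A32 j k⟩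
end

section
/- There exist a sequence of payoff vectors g : ℕ → (Fin 2 → ℝ) with g_t(k) ∈ [0, 1] for all t and k, and a sequence of actions a : ℕ → Fin 2 such that for every t ≥ 2 the action a(t) maximizes the cumulative past payoff k ↦ ∑_{s=1}^{t−1} g_s(k) (i.e., a is a Follow-the-Leader play), yet limsup_{T→∞} (1/T) ( max_{k ∈ Fin 2} ∑_{t=1}^{T} g_t(k) − ∑_{t=1}^{T} g_t(a(t)) ) > 0. (Part of Proposition 4.4: the Follow-the-Leader algorithm is not no-regret.) -/
open Filter Finset
open scoped Classical Topology

/-- The payoff sequence rewarding action `1` in odd rounds and action `0` in even rounds. -/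
def alternatingPayoff (t : ℕ) (k : Fin 2) : ℝ := if (k : ℕ) = t % 2 then 1 else 0

/-- The play choosing, in each round, the action not rewarded by `alternatingPayoff`. -/
def laggingPlay (t : ℕ) : Fin 2 := if t % 2 = 0 then 1 else 0

lemma sum_alternatingPayoff (T : ℕ) (k : Fin 2) :
    ∑ t ∈ Finset.Icc 1 T, alternatingPayoff t k = (((T + k) / 2 : ℕ) : ℝ) := by
  induction T with
  | zero => fin_cases k <;> simp
  | succ n ih =>
    rw [Finset.sum_Icc_succ_top (by omega), ih, alternatingPayoff]
    have hk := k.isLt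
    split_ifs with h
    · rw [show (n + 1 + k) / 2 = (n + k) / 2 + 1 by omega]
      push_cast
      rfl
    · rw [show (n + 1 + k) / 2 = (n + k) / 2 by omega, add_zero]

lemma alternatingPayoff_laggingPlay (t : ℕ) : alternatingPayoff t (laggingPlay t) = 0 := by
  rcases Nat.mod_two_eq_zero_or_one t with h | h <;> simp [alternatingPayoff, laggingPlay, h]

lemma sup'_sum_alternatingPayoff (T : ℕ) :
    Finset.univ.sup' Finset.univ_nonempty
      (fun k : Fin 2 => ∑ t ∈ Finset.Icc 1 T, alternatingPayoff t k) =
      (((T + 1) / 2 : ℕ) : ℝ) := by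
  simp only [sum_alternatingPayoff]
  apply le_antisymm
  · refine Finset.sup'_le _ _ fun k _ => ?_
    have hk := k.isLt
    exact_mod_cast (by omega : (T + k) / 2 ≤ (T + 1) / 2)
  · exact Finset.le_sup' (fun k : Fin 2 => (((T + k) / 2 : ℕ) : ℝ)) (Finset.mem_univ 1)

/-- Part of Proposition 4.4: the Follow-the-Leader algorithm is not no-regret.
There is a `[0,1]`-valued payoff sequence on two actions and an FTL-consistent play
whose average regret does not vanish. -/
theorem stmt_9 : ∃ (g : ℕ → Fin 2 → ℝ) (a : ℕ → Fin 2),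
    (∀ (t : ℕ) (k : Fin 2), g t k ∈ Set.Icc (0 : ℝ) 1) ∧
    (∀ t : ℕ, 2 ≤ t → ∀ k : Fin 2,
      ∑ s ∈ Finset.Icc 1 (t - 1), g s k ≤ ∑ s ∈ Finset.Icc 1 (t - 1), g s (a t)) ∧
    0 < Filter.limsup (fun T : ℕ => (1 / (T : ℝ)) *
        ((Finset.univ.sup' Finset.univ_nonempty
            (fun k : Fin 2 => ∑ t ∈ Finset.Icc 1 T, g t k)) -
          ∑ t ∈ Finset.Icc 1 T, g t (a t))) Filter.atTop := by
  refine ⟨alternatingPayoff, laggingPlay, fun t k => ?_, fun t ht k => ?_, ?_⟩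
  · unfold alternatingPayoff
    split_ifs <;> simp
  · rw [sum_alternatingPayoff, sum_alternatingPayoff]
    have hk := k.isLt
    have hle : (t - 1 + k) / 2 ≤ (t - 1 + laggingPlay t) / 2 := by
      unfold laggingPlay
      split_ifs with h <;> simp <;> omega
    exact_mod_cast hle
  · simp only [alternatingPayoff_laggingPlay, Finset.sum_const_zero, sub_zero,
      sup'_sum_alternatingPayoff]
    refine lt_of_lt_of_le (by norm_num : (0 : ℝ) < 1 / 2)
      (le_limsup_of_frequently_le (Eventually.frequently ?_) ?_)
    · filter_upwards [eventually_ge_atTop 1] with T hT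
      have hpos : (0 : ℝ) < T := by exact_mod_cast hT
      have hle : (T : ℝ) ≤ 2 * ((T + 1) / 2 : ℕ) := by
        exact_mod_cast (by omega : T ≤ 2 * ((T + 1) / 2))
      rw [one_div_mul_eq_div, le_div_iff₀ hpos]
      linarith
    · refine isBoundedUnder_of ⟨1, fun T => ?_⟩
      rw [one_div_mul_eq_div]
      exact div_le_one_of_le₀ (by exact_mod_cast (by omega : (T + 1) / 2 ≤ T)) T.cast_nonneg
end

section
/- Define the clock distance d(i, j) = min(|i − j|, 12 − |i − j|) on {0, …, 11} and, for 0 < ε ≤ 2, define the 12×12 matrix Â by Â(k, l) = d(k, l) − ε if d(k, l) < 6 and Â(k, l) = d(k, l) + ε if d(k, l) = 6. Then: (i) for every j ≠ 6 and every k ∈ {0, …, 11}, Â(0, 6) + d(6, k) > Â(0, j) + d(j, k) (action 6 is strictly dominant for player 2 against player 1's fixed position 0); (ii) for every k ≠ 6 and every j ∈ {0, …, 11}, Â(0, 6) + d(j, 6) > Â(0, k) + d(j, k) (action 6 is strictly dominant for player 3 against player 1's fixed position 0); (iii) ‖Â − D‖∞ = ε where D(k, l) = d(k, l), and the single-round utilities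 at the profile (0, 6, 6) satisfy u1 = d(0, 6) + d(0, 6) − 2‖Â − D‖∞ = 12 − 2ε, u2 = u3 = Â(0, 6) + d(6, 6) = 6 + ε, and u1 ≥ u2 and u1 ≥ u3. (Winning dominance solvable type-I policy for the social distancing game with infinitesimal manipulation cost.) -/
/-- The clock distance between two of the 12 positions, as a natural number. -/
def clockDistN (i j : Fin 12) : ℕ :=
  min ((i.val : ℤ) - (j.val : ℤ)).natAbs (12 - ((i.val : ℤ) - (j.val : ℤ)).natAbs)

/-- The clock distance as a real number. -/
noncomputable def clockDist (i j : Fin 12) : ℝ := (clockDistN i j : ℝ)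

/-- The original payoff matrix of the social distancing game: the distance matrix. -/
noncomputable def Dmat : Matrix (Fin 12) (Fin 12) ℝ := fun i j => clockDist i j

/-- The manipulated matrix `Â`: subtract `ε` where the distance is `< 6` and add `ε`
where the distance is `= 6`. -/
noncomputable def Ahat (ε : ℝ) : Matrix (Fin 12) (Fin 12) ℝ := fun k l =>
  if clockDistN k l < 6 then clockDist k l - ε else clockDist k l + ε

theorem clockDistN_comm (i j : Fin 12) : clockDistN i j = clockDistN j i := by
  revert i j; decide

theorem clockDist_comm (i j : Fin 12) : clockDist i j = clockDist j i := by
  simp only [clockDist, clockDistN_comm i j]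

/-- Position `6` is antipodal to `0`, so no path from `0` through `j` to `k` is longer than
the one through `6`. -/
theorem clockDistN_zero_add_le (j k : Fin 12) :
    clockDistN 0 j + clockDistN j k ≤ 6 + clockDistN 6 k := by
  revert j k; decide

theorem clockDistN_zero_lt_six {j : Fin 12} (hj : j ≠ 6) : clockDistN 0 j < 6 := by
  revert j; decide

theorem clockDist_zero_six : clockDist 0 6 = 6 := by
  have h : clockDistN 0 6 = 6 := by decide
  simp [clockDist, h]

theorem clockDist_self (i : Fin 12) : clockDist i i = 0 := by
  simp [clockDist, clockDistN]

theorem Ahat_zero_six (ε : ℝ) : Ahat ε 0 6 = 6 + ε := by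
  have h : ¬ clockDistN 0 6 < 6 := by decide
  simp only [Ahat, if_neg h, clockDist_zero_six]

theorem Ahat_zero_six_add_gt {ε : ℝ} (hε : 0 < ε) {j : Fin 12} (hj : j ≠ 6) (k : Fin 12) :
    Ahat ε 0 6 + clockDist 6 k > Ahat ε 0 j + clockDist j k := by
  have h : clockDist 0 j + clockDist j k ≤ 6 + clockDist 6 k := by
    simp only [clockDist]
    exact_mod_cast clockDistN_zero_add_le j k
  rw [Ahat_zero_six, Ahat, if_pos (clockDistN_zero_lt_six hj)]
  linarith

theorem infNorm_Ahat_sub_Dmat {ε : ℝ} (hε : 0 ≤ ε) : infNorm (Ahat ε - Dmat) = ε := by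
  have h (i j : Fin 12) : |(Ahat ε - Dmat) i j| = ε := by
    simp only [Matrix.sub_apply, Ahat, Dmat]
    split_ifs <;> simp [abs_of_nonneg hε]
  simp only [infNorm, h, ciSup_const]

/-- Winning dominance solvable type-I policy for the social distancing game with
infinitesimal manipulation cost: player 1 plays position `0`, position `6` becomes
strictly dominant for both opponents, and at the profile `(0, 6, 6)` player 1's
utility `12 - 2ε` dominates the opponents' `6 + ε`. -/
theorem stmt_12 (ε : ℝ) (hε : 0 < ε) (hε' : ε ≤ 2) :
    (∀ j : Fin 12, j ≠ 6 → ∀ k : Fin 12,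
      Ahat ε 0 6 + clockDist 6 k > Ahat ε 0 j + clockDist j k) ∧
    (∀ k : Fin 12, k ≠ 6 → ∀ j : Fin 12,
      Ahat ε 0 6 + clockDist j 6 > Ahat ε 0 k + clockDist j k) ∧
    infNorm (Ahat ε - Dmat) = ε ∧
    clockDist 0 6 + clockDist 0 6 - 2 * infNorm (Ahat ε - Dmat) = 12 - 2 * ε ∧
    Ahat ε 0 6 + clockDist 6 6 = 6 + ε ∧
    12 - 2 * ε ≥ 6 + ε := by
  refine ⟨fun j hj k => Ahat_zero_six_add_gt hε hj k, fun k hk j => ?_,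
    infNorm_Ahat_sub_Dmat hε.le, ?_, ?_, by linarith⟩
  · rw [clockDist_comm j 6, clockDist_comm j k]
    exact Ahat_zero_six_add_gt hε hk j
  · rw [infNorm_Ahat_sub_Dmat hε.le, clockDist_zero_six]
    ring
  · rw [Ahat_zero_six, clockDist_self, add_zero]
end
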